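/- Let β be the sequence of natural numbers defined for n ≥ 10 by β(10) = 10 and β(n+1) = β(n) _ (n+1). Then log log β(n) is asymptotic to n · log log n as n → ∞; that is, the ratio (log log β(n)) / (n · log log n) tends to 1, where log denotes the logarithm to base 10. -/

import Mathlib

open Real Filter

/-- The dungeon operation: interpret the base-10 digits of `a` in base `b`. -/
def dungeon (a b : ℕ) : ℕ := Nat.ofDigits b (Nat.digits 10 a)

theorem dungeon_eq_mod_add (a b : ℕ) (ha : a ≠ 0) :
    dungeon a b = a % 10 + b * dungeon (a / 10) b := by
  unfold dungeon
  rw [Nat.digits_def' (by norm_num) (Nat.pos_of_ne_zero ha), Nat.ofDigits_cons]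

theorem dungeon_of_lt_ten {a : ℕ} (b : ℕ) (ha : a < 10) : dungeon a b = a := by
  rcases eq_or_ne a 0 with rfl | h0
  · simp [dungeon]
  · rw [dungeon, Nat.digits_of_lt 10 a h0 ha, Nat.ofDigits_singleton]

theorem le_dungeon (a : ℕ) {b : ℕ} (hb : 10 ≤ b) : a ≤ dungeon a b := by
  calc a = Nat.ofDigits 10 (Nat.digits 10 a) := (Nat.ofDigits_digits 10 a).symm
    _ ≤ dungeon a b := Nat.ofDigits_monotone _ hb

theorem lt_dungeon {a b : ℕ} (ha : 10 ≤ a) (hb : 11 ≤ b) : a < dungeon a b := by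
  rw [dungeon_eq_mod_add a b (by omega)]
  have h := le_dungeon (a / 10) (b := b) (by omega)
  have h2 : 11 * (a / 10) ≤ b * dungeon (a / 10) b := Nat.mul_le_mul hb h
  omega

theorem pow_log_le_dungeon {a b : ℕ} (ha : a ≠ 0) :
    b ^ Nat.log 10 a ≤ dungeon a b := by
  induction a using Nat.strong_induction_on with
  | _ a ih =>
    rcases lt_or_ge a 10 with h | h
    · rw [dungeon_of_lt_ten b h, Nat.log_of_lt h, pow_zero]
      omega
    · rw [dungeon_eq_mod_add a b ha, Nat.log_of_one_lt_of_le (by norm_num) h, pow_succ']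
      have := Nat.mul_le_mul_left b (ih (a / 10) (by omega) (by omega))
      omega

theorem dungeon_lt_ten_mul_pow_log (a : ℕ) {b : ℕ} (hb : 10 ≤ b) :
    dungeon a b < 10 * b ^ Nat.log 10 a := by
  induction a using Nat.strong_induction_on with
  | _ a ih =>
    rcases lt_or_ge a 10 with h | h
    · rw [dungeon_of_lt_ten b h, Nat.log_of_lt h, pow_zero]
      omega
    · rw [dungeon_eq_mod_add a b (by omega), Nat.log_of_one_lt_of_le (by norm_num) h, pow_succ']
      have := Nat.mul_le_mul_left b (ih (a / 10) (by omega))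
      have hm : a % 10 < 10 := Nat.mod_lt _ (by norm_num)
      rw [Nat.succ_eq_add_one, mul_add, mul_one] at this
      linarith

theorem logb_dungeon_le {a b : ℕ} (ha : a ≠ 0) (hb : 10 ≤ b) :
    logb 10 (dungeon a b) ≤ logb 10 a * logb 10 b + 1 := by
  have hbpos : (0 : ℝ) < b := by exact_mod_cast (by omega : 0 < b)
  have hlogb : 0 ≤ logb 10 (b : ℝ) :=
    logb_nonneg (by norm_num) (by exact_mod_cast (by omega : 1 ≤ b))
  have hd : (0 : ℝ) < dungeon a b := by
    exact_mod_cast (Nat.pos_of_ne_zero ha).trans_le (le_dungeon a hb)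
  have hk : (Nat.log 10 a : ℝ) ≤ logb 10 a := by
    simpa using Real.natLog_le_logb a 10
  calc logb 10 (dungeon a b) ≤ logb 10 (10 * (b : ℝ) ^ Nat.log 10 a) := by
        apply logb_le_logb_of_le (by norm_num) hd
        exact_mod_cast (dungeon_lt_ten_mul_pow_log a hb).le
    _ = Nat.log 10 a * logb 10 b + 1 := by
        rw [logb_mul (by norm_num) (by positivity), logb_pow, logb_self_eq_one (by norm_num),
          add_comm]
    _ ≤ _ := by gcongr

theorem le_logb_dungeon {a b : ℕ} (ha : a ≠ 0) (hb : 1 ≤ b) :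
    (logb 10 a - 1) * logb 10 b ≤ logb 10 (dungeon a b) := by
  have hbpos : (0 : ℝ) < b := by exact_mod_cast hb
  have hlogb : 0 ≤ logb 10 (b : ℝ) := logb_nonneg (by norm_num) (by exact_mod_cast hb)
  have hk : logb 10 a - 1 ≤ Nat.log 10 a := by
    have ha' : (0 : ℝ) < a := by exact_mod_cast Nat.pos_of_ne_zero ha
    have h : (a : ℝ) ≤ 10 ^ (Nat.log 10 a + 1) := by
      exact_mod_cast (Nat.lt_pow_succ_log_self (by norm_num) a).le
    have h2 := logb_le_logb_of_le (b := 10) (by norm_num) ha' h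
    rw [logb_pow, logb_self_eq_one (by norm_num)] at h2
    push_cast at h2
    linarith
  calc (logb 10 a - 1) * logb 10 b ≤ Nat.log 10 a * logb 10 b := by gcongr
    _ = logb 10 ((b : ℝ) ^ Nat.log 10 a) := (logb_pow ..).symm
    _ ≤ _ := by
        apply logb_le_logb_of_le (by norm_num) (by positivity)
        exact_mod_cast pow_log_le_dungeon ha

theorem tendsto_nat_logb_ten_atTop : Tendsto (fun n : ℕ => logb 10 (n : ℝ)) atTop atTop :=
  (tendsto_logb_atTop (by norm_num)).comp tendsto_natCast_atTop_atTop

theorem logb_ten_le_sub_one {x : ℝ} (hx : 1 ≤ x) : logb 10 x ≤ x - 1 := by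
  have h10 : 1 ≤ Real.log 10 := by
    rw [Real.le_log_iff_exp_le (by norm_num)]
    linarith [Real.exp_one_lt_d9]
  have h := Real.log_le_sub_one_of_pos (by linarith : 0 < x)
  rw [logb, div_le_iff₀ (by linarith)]
  nlinarith

theorem tendsto_nat_mul_logb_logb_succ_sub :
    Tendsto (fun n : ℕ => (n : ℝ) *
      (logb 10 (logb 10 ((n + 1 : ℕ) : ℝ)) - logb 10 (logb 10 (n : ℝ)))) atTop (nhds 0) := by
  apply squeeze_zero' (g := fun n : ℕ => (logb 10 (n : ℝ))⁻¹) _ _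
    tendsto_nat_logb_ten_atTop.inv_tendsto_atTop
  all_goals
    filter_upwards [eventually_ge_atTop 2] with n hn
    have hn' : (2 : ℝ) ≤ n := by exact_mod_cast hn
    have hpos : 0 < logb 10 (n : ℝ) := logb_pos (by norm_num) (by linarith)
    have hle : logb 10 (n : ℝ) ≤ logb 10 ((n + 1 : ℕ) : ℝ) :=
      logb_le_logb_of_le (by norm_num) (by linarith) (by push_cast; linarith)
  · exact mul_nonneg (by linarith) (sub_nonneg.2 (logb_le_logb_of_le (by norm_num) hpos hle))
  · have h1 : logb 10 ((n + 1 : ℕ) : ℝ) - logb 10 (n : ℝ) ≤ 1 / n := by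
      rw [← logb_div (by positivity) (by positivity)]
      refine (logb_ten_le_sub_one ?_).trans (le_of_eq ?_)
      · rw [le_div_iff₀ (by linarith)]
        push_cast
        linarith
      · push_cast
        field_simp
        ring
    rw [← logb_div (by linarith) hpos.ne']
    have h2 := logb_ten_le_sub_one ((one_le_div hpos).2 hle)
    calc (n : ℝ) * logb 10 (logb 10 ((n + 1 : ℕ) : ℝ) / logb 10 (n : ℝ))
        ≤ n * ((logb 10 ((n + 1 : ℕ) : ℝ) - logb 10 (n : ℝ)) / logb 10 (n : ℝ)) := by
          rw [sub_div, div_self hpos.ne']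
          gcongr
      _ ≤ n * (1 / n / logb 10 (n : ℝ)) := by gcongr
      _ = _ := by field_simp

theorem tendsto_div_natCast_of_tendsto_succ_sub {u : ℕ → ℝ}
    (h : Tendsto (fun n => u (n + 1) - u n) atTop (nhds 0)) :
    Tendsto (fun n : ℕ => u n / n) atTop (nhds 0) := by
  have h1 := h.cesaro.add (tendsto_const_div_atTop_nhds_zero_nat (u 0))
  rw [add_zero] at h1
  refine h1.congr fun n => ?_
  rw [Finset.sum_range_sub]
  ring

theorem le_of_dungeon_recurrence {β : ℕ → ℕ} (hβ0 : β 10 = 10)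
    (hβ : ∀ n, 10 ≤ n → β (n + 1) = dungeon (β n) (n + 1)) {n : ℕ} (hn : 10 ≤ n) :
    n ≤ β n := by
  induction n, hn using Nat.le_induction with
  | base => exact hβ0.ge
  | succ n hn ih =>
    rw [hβ n hn]
    exact ih.trans_lt (lt_dungeon (hn.trans ih) (by omega))

theorem beta_loglog_asymptotic (β : ℕ → ℕ) (hβ0 : β 10 = 10)
    (hβ : ∀ n, 10 ≤ n → β (n + 1) = dungeon (β n) (n + 1)) :
    Tendsto (fun n : ℕ =>
        logb 10 (logb 10 (β n)) / (n * logb 10 (logb 10 n))) atTop (nhds 1) := by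
  set L : ℕ → ℝ := fun n => logb 10 (β n)
  set l : ℕ → ℝ := fun n => logb 10 (n : ℝ) with hl
  have hl_top : Tendsto l atTop atTop := tendsto_nat_logb_ten_atTop
  have hl_le (n : ℕ) (hn : 10 ≤ n) : l n ≤ L n :=
    logb_le_logb_of_le (by norm_num) (by exact_mod_cast (by omega : 0 < n))
      (by exact_mod_cast le_of_dungeon_recurrence hβ0 hβ hn)
  have hL_top : Tendsto L atTop atTop :=
    tendsto_atTop_mono' _ ((eventually_ge_atTop 10).mono hl_le) hl_top
  have hl_succ : Tendsto (fun n => l (n + 1)) atTop atTop :=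
    hl_top.comp (tendsto_add_atTop_nat 1)
  have hratio : Tendsto (fun n => L (n + 1) / (L n * l (n + 1))) atTop (nhds 1) := by
    have hlow : Tendsto (fun n => 1 - (L n)⁻¹) atTop (nhds 1) := by
      simpa using tendsto_const_nhds.sub hL_top.inv_tendsto_atTop
    have hupp : Tendsto (fun n => 1 + (L n * l (n + 1))⁻¹) atTop (nhds 1) := by
      simpa using tendsto_const_nhds.add (hL_top.atTop_mul_atTop₀ hl_succ).inv_tendsto_atTop
    refine tendsto_of_tendsto_of_tendsto_of_le_of_le' hlow hupp ?_ ?_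
    all_goals
      filter_upwards [eventually_ge_atTop 10, hL_top.eventually_gt_atTop 0,
        hl_succ.eventually_gt_atTop 0] with n hn hLn hln
      have hne : β n ≠ 0 := by
        have := le_of_dungeon_recurrence hβ0 hβ hn
        omega
    · rw [le_div_iff₀ (by positivity)]
      have h := le_logb_dungeon hne (b := n + 1) (by omega)
      rw [← hβ n hn] at h
      calc (1 - (L n)⁻¹) * (L n * l (n + 1)) = (L n - 1) * l (n + 1) := by field_simp
        _ ≤ L (n + 1) := h
    · rw [div_le_iff₀ (by positivity)]
      have h := logb_dungeon_le hne (b := n + 1) (by omega)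
      rw [← hβ n hn] at h
      calc L (n + 1) ≤ L n * l (n + 1) + 1 := h
        _ = (1 + (L n * l (n + 1))⁻¹) * (L n * l (n + 1)) := by field_simp
  have hlog : Tendsto (fun n => logb 10 (L (n + 1) / (L n * l (n + 1)))) atTop (nhds 0) := by
    have h := (hratio.log one_ne_zero).div_const (Real.log 10)
    simpa [logb] using h
  have hE : Tendsto (fun n : ℕ => (logb 10 (L n) - n * logb 10 (l n)) / n) atTop (nhds 0) := by
    apply tendsto_div_natCast_of_tendsto_succ_sub (u := fun n => logb 10 (L n) - n * logb 10 (l n))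
    have h := hlog.sub tendsto_nat_mul_logb_logb_succ_sub
    rw [sub_zero] at h
    refine h.congr' ?_
    filter_upwards [hL_top.eventually_gt_atTop 0, hl_succ.eventually_gt_atTop 0,
      (hL_top.comp (tendsto_add_atTop_nat 1)).eventually_gt_atTop 0] with n hLn hln hLn'
    rw [Function.comp_apply] at hLn'
    rw [logb_div hLn'.ne' (by positivity), logb_mul hLn.ne' hln.ne']
    simp only [hl]
    push_cast
    ring
  have hll_top : Tendsto (fun n => logb 10 (l n)) atTop atTop :=
    (tendsto_logb_atTop (by norm_num)).comp hl_top
  have hfin := (hE.mul hll_top.inv_tendsto_atTop).const_add 1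
  rw [zero_mul, add_zero] at hfin
  refine hfin.congr' ?_
  filter_upwards [eventually_gt_atTop 0, hll_top.eventually_gt_atTop 0] with n hn hlln
  have hn' : (n : ℝ) ≠ 0 := by exact_mod_cast hn.ne'
  change 1 + (logb 10 (L n) - n * logb 10 (l n)) / n * (logb 10 (l n))⁻¹ =
    logb 10 (L n) / (n * logb 10 (l n))
  have hlln' := hlln.ne'
  field_simp
  ring
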